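/- Let -1 ≤ B < A ≤ 1, f ∈ S*(A,B), δ = (1-A)/(1-B), and F(w) = w + Σ_{n≥2} A_n wⁿ the inverse of f near the origin. Fix n ≥ 2 and suppose (n-1)/n ≤ δ < 1. Then |A_n| ≤ (A-B)/(n-1). -/

import Mathlib

open Metric Complex

/-- The class `S*(A,B)`. -/
def IsJanowskiStarlike (A B : ℝ) (f : ℂ → ℂ) : Prop :=
  AnalyticOn ℂ f (ball 0 1) ∧ f 0 = 0 ∧ deriv f 0 = 1 ∧
    ∃ ω : ℂ → ℂ, AnalyticOn ℂ ω (ball 0 1) ∧ (∀ z ∈ ball (0 : ℂ) 1, ‖ω z‖ ≤ 1) ∧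
      ∀ z ∈ ball (0 : ℂ) 1,
        z * deriv f z * (1 + (B : ℂ) * z * ω z) = f z * (1 + (A : ℂ) * z * ω z)

/-- `a` is the sequence of Taylor coefficients of the branch of `(f z / z) ^ (-lam)`
normalized to equal `1` at the origin. -/
def NegPowCoeff (lam : ℝ) (f : ℂ → ℂ) (a : ℕ → ℂ) : Prop :=
  ∃ h : ℂ → ℂ, AnalyticOn ℂ h (ball 0 1) ∧ h 0 = 0 ∧
    (∀ z ∈ ball (0 : ℂ) 1, f z = z * Complex.exp (h z)) ∧
    a 0 = 1 ∧
    ∀ z ∈ ball (0 : ℂ) 1,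
      HasSum (fun n : ℕ => a n * z ^ n) (Complex.exp (-(lam : ℂ) * h z))

open scoped Topology Nat
open PowerSeries in
/-- Taylor series at the origin, as a formal power series. -/
noncomputable def taylorPS (g : ℂ → ℂ) : PowerSeries ℂ :=
  PowerSeries.mk fun k => iteratedDeriv k g 0 / (k ! : ℂ)

lemma taylorPS_congr {g h : ℂ → ℂ} (e : g =ᶠ[𝓝 0] h) : taylorPS g = taylorPS h := by
  ext k
  simp [taylorPS, e.iteratedDeriv_eq]

lemma taylorPS_add {g h : ℂ → ℂ} (hg : AnalyticAt ℂ g 0) (hh : AnalyticAt ℂ h 0) :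
    taylorPS (fun z => g z + h z) = taylorPS g + taylorPS h := by
  ext k
  simp [taylorPS, iteratedDeriv_fun_add hg.contDiffAt hh.contDiffAt, add_div]

lemma taylorPS_mul {g h : ℂ → ℂ} (hg : AnalyticAt ℂ g 0) (hh : AnalyticAt ℂ h 0) :
    taylorPS (fun z => g z * h z) = taylorPS g * taylorPS h := by
  ext k
  simp only [taylorPS, PowerSeries.coeff_mk, iteratedDeriv_fun_mul hg.contDiffAt hh.contDiffAt,
    PowerSeries.coeff_mul, Finset.sum_div,
    Finset.Nat.sum_antidiagonal_eq_sum_range_succ_mk, Nat.succ_eq_add_one]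
  refine Finset.sum_congr rfl fun i hi ↦ ?_
  rw [Nat.cast_choose _ (by grind)]
  field_simp [Nat.factorial_ne_zero]

lemma taylorPS_const (c : ℂ) : taylorPS (fun _ => c) = PowerSeries.C c := by
  ext k
  simp only [taylorPS, PowerSeries.coeff_mk, iteratedDeriv_const, PowerSeries.coeff_C]
  split_ifs with h <;> simp [h]

lemma taylorPS_id : taylorPS (fun z => z) = PowerSeries.X := by
  ext k
  simp only [taylorPS, PowerSeries.coeff_mk, iteratedDeriv_fun_id_zero, PowerSeries.coeff_X]
  split_ifs with h <;> simp [h]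

lemma taylorPS_pow {g : ℂ → ℂ} (hg : AnalyticAt ℂ g 0) (k : ℕ) :
    taylorPS (fun z => g z ^ k) = taylorPS g ^ k := by
  induction k with
  | zero => simp [taylorPS_const]
  | succ k ih =>
    simp only [pow_succ]
    rw [taylorPS_mul (hg.fun_pow k) hg, ih]

lemma taylorPS_sum (s : Finset ℕ) {g : ℕ → ℂ → ℂ} (hg : ∀ i, AnalyticAt ℂ (g i) 0) :
    taylorPS (fun z => ∑ i ∈ s, g i z) = ∑ i ∈ s, taylorPS (g i) := by
  classical
  induction s using Finset.induction_on with
  | empty => simp [taylorPS_const]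
  | insert a s ha ih =>
    simp only [Finset.sum_insert ha]
    rw [taylorPS_add (hg a) (Finset.analyticAt_fun_sum _ fun i _ => hg i), ih]

lemma taylorPS_deriv (g : ℂ → ℂ) :
    taylorPS (deriv g) = PowerSeries.derivative ℂ (taylorPS g) := by
  ext k
  simp only [taylorPS, PowerSeries.coeff_mk, PowerSeries.coeff_derivative, iteratedDeriv_succ']
  have : (k ! : ℂ) ≠ 0 := by exact_mod_cast Nat.factorial_ne_zero k
  have : (k + 1 : ℂ) ≠ 0 := by exact_mod_cast Nat.succ_ne_zero k
  rw [Nat.factorial_succ]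
  push_cast
  field_simp

/-- Parseval for a polynomial presented by its coefficients. -/
lemma parseval_range (c : ℕ → ℂ) (N : ℕ) :
    ∑ k ∈ Finset.range N, ‖c k‖ ^ 2 =
      Real.circleAverage (fun z => ‖∑ k ∈ Finset.range N, c k * z ^ k‖ ^ 2) 0 1 := by
  have h := Polynomial.sum_sq_norm_coeff_eq_circleAverage
    (∑ k ∈ Finset.range N, Polynomial.monomial k (c k))
  have hc : ∀ i, (∑ k ∈ Finset.range N, Polynomial.monomial k (c k)).coeff i =
      if i < N then c i else 0 := by
    intro i
    simp [Polynomial.finsetSum_coeff, Polynomial.coeff_monomial]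
  simp only [Polynomial.eval_finsetSum, Polynomial.eval_monomial] at h
  rw [← h]
  symm
  rw [Finset.sum_subset (s₂ := Finset.range N)]
  · refine Finset.sum_congr rfl fun i hi => ?_
    rw [hc, if_pos (Finset.mem_range.mp hi)]
  · intro i hi
    rw [Polynomial.mem_support_iff, hc] at hi
    by_contra h2
    simp_all
  · intro i _ hi
    rw [Polynomial.notMem_support_iff.mp hi]
    simp

lemma circleIntegrable_poly (c : ℕ → ℂ) (N : ℕ) :
    CircleIntegrable (fun z => ‖∑ k ∈ Finset.range N, c k * z ^ k‖ ^ 2) 0 1 := by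
  apply ContinuousOn.circleIntegrable (by norm_num)
  fun_prop

lemma bessel_aux {R : ℂ → ℂ} (hR : DifferentiableOn ℂ R (ball 0 1)) (q : ℕ → ℂ) (M : ℕ)
    (hle : ∀ z ∈ ball (0 : ℂ) 1, ‖R z‖ ≤ ‖∑ k ∈ Finset.range M, q k * z ^ k‖)
    (r : ℝ) (hr0 : 0 < r) (hr1 : r < 1) :
    ∑ k ∈ Finset.range M, ‖PowerSeries.coeff k (taylorPS R) * r ^ k‖ ^ 2 ≤
      ∑ k ∈ Finset.range M, ‖q k * r ^ k‖ ^ 2 := by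
  set t : ℕ → ℂ := fun k => PowerSeries.coeff k (taylorPS R) * r ^ k with ht
  have hsum : ∀ z : ℂ, ‖z‖ = 1 → HasSum (fun k => t k * z ^ k) (R (r * z)) := by
    intro z hz
    have hm : (r * z : ℂ) ∈ ball (0 : ℂ) 1 := by
      simp [hz, abs_of_pos hr0, hr1]
    have := Complex.hasSum_taylorSeries_on_ball hR hm
    refine (congrArg (fun c => HasSum c (R (r * z))) (funext fun k => ?_)).mpr this
    simp only [ht, taylorPS, PowerSeries.coeff_mk, smul_eq_mul, sub_zero, mul_pow]
    ring
  have hts : Summable fun k => ‖t k‖ := by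
    simpa using (hsum 1 (by simp)).summable.norm
  have key : ∀ N, M ≤ N → ∑ k ∈ Finset.range M, ‖t k‖ ^ 2 ≤
      (1 + ∑' k, ‖t (k + N)‖) * ∑ k ∈ Finset.range M, ‖q k * r ^ k‖ ^ 2 +
        ((∑' k, ‖t (k + N)‖) + (∑' k, ‖t (k + N)‖) ^ 2) := by
    intro N hN
    set ε := ∑' k, ‖t (k + N)‖ with hε
    have hε0 : 0 ≤ ε := tsum_nonneg fun _ => norm_nonneg _
    calc ∑ k ∈ Finset.range M, ‖t k‖ ^ 2 ≤ ∑ k ∈ Finset.range N, ‖t k‖ ^ 2 :=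
          Finset.sum_le_sum_of_subset_of_nonneg (Finset.range_mono hN)
            (fun _ _ _ => by positivity)
      _ = Real.circleAverage (fun z => ‖∑ k ∈ Finset.range N, t k * z ^ k‖ ^ 2) 0 1 :=
          parseval_range _ _
      _ ≤ Real.circleAverage (fun z =>
            (1 + ε) • ‖∑ k ∈ Finset.range M, (q k * r ^ k) * z ^ k‖ ^ 2 + (ε + ε ^ 2)) 0 1 := by
          apply Real.circleAverage_mono (circleIntegrable_poly _ _)
          · apply ContinuousOn.circleIntegrable (by norm_num)
            fun_prop
          intro z hz
          have hz1 : ‖z‖ = 1 := by simpa using hz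
          have h1 : ‖∑ k ∈ Finset.range N, t k * z ^ k‖ ≤
              ‖∑ k ∈ Finset.range M, (q k * r ^ k) * z ^ k‖ + ε := by
            have e1 := (hsum z hz1).summable.sum_add_tsum_nat_add N
            rw [(hsum z hz1).tsum_eq] at e1
            have e2 : ‖∑' k, t (k + N) * z ^ (k + N)‖ ≤ ε := by
              have hs : Summable fun k => ‖t (k + N) * z ^ (k + N)‖ := by
                simpa [hz1] using (summable_nat_add_iff N).mpr hts
              refine (norm_tsum_le_tsum_norm hs).trans (le_of_eq ?_)
              simp [hz1, hε]
            have hm : (r * z : ℂ) ∈ ball (0 : ℂ) 1 := by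
              simp [hz1, abs_of_pos hr0, hr1]
            have e3 := hle _ hm
            have e4 : ∑ k ∈ Finset.range M, q k * (r * z : ℂ) ^ k =
                ∑ k ∈ Finset.range M, (q k * r ^ k) * z ^ k :=
              Finset.sum_congr rfl fun k _ => by ring
            rw [e4] at e3
            rw [eq_sub_of_add_eq e1]
            exact (norm_sub_le _ _).trans (add_le_add e3 e2)
          have h0 := norm_nonneg (∑ k ∈ Finset.range N, t k * z ^ k)
          simp only [smul_eq_mul]
          set a := ‖∑ k ∈ Finset.range M, (q k * r ^ k) * z ^ k‖
          have h2 := pow_le_pow_left₀ h0 h1 2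
          nlinarith [mul_nonneg hε0 (sq_nonneg (a - 1))]
      _ = _ := by
          rw [Real.circleAverage_fun_add, Real.circleAverage_fun_smul, ← parseval_range,
            Real.circleAverage_const, smul_eq_mul]
          · apply ContinuousOn.circleIntegrable (by norm_num)
            fun_prop
          · exact circleIntegrable_const _ _ _
  have hlim : Filter.Tendsto (fun N => ∑' k, ‖t (k + N)‖) Filter.atTop (𝓝 0) :=
    tendsto_sum_nat_add fun k => ‖t k‖
  have hlim2 : Filter.Tendsto (fun N => (1 + ∑' k, ‖t (k + N)‖) *
      ∑ k ∈ Finset.range M, ‖q k * r ^ k‖ ^ 2 +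
        ((∑' k, ‖t (k + N)‖) + (∑' k, ‖t (k + N)‖) ^ 2)) Filter.atTop
        (𝓝 ((1 + 0) * ∑ k ∈ Finset.range M, ‖q k * r ^ k‖ ^ 2 + (0 + 0 ^ 2))) :=
    ((hlim.const_add 1).mul_const _).add (hlim.add (hlim.pow 2))
  have := ge_of_tendsto hlim2 (Filter.eventually_atTop.mpr ⟨M, key⟩)
  rw [zero_pow two_ne_zero, add_zero, add_zero, add_zero, one_mul] at this
  exact this

lemma clunie {ω : ℂ → ℂ} (hω : DifferentiableOn ℂ ω (ball 0 1))
    (hb : ∀ z ∈ ball (0 : ℂ) 1, ‖ω z‖ ≤ 1) (Q : PowerSeries ℂ) (M : ℕ) :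
    ∑ k ∈ Finset.range M, ‖PowerSeries.coeff k (taylorPS ω * Q)‖ ^ 2 ≤
      ∑ k ∈ Finset.range M, ‖PowerSeries.coeff k Q‖ ^ 2 := by
  set q : ℕ → ℂ := fun k => PowerSeries.coeff k Q with hq
  set P : ℂ → ℂ := fun z => ∑ k ∈ Finset.range M, q k * z ^ k with hP
  have hPd : Differentiable ℂ P := by
    simp only [hP]; fun_prop
  have hωa : AnalyticAt ℂ ω 0 := hω.analyticAt (ball_mem_nhds _ one_pos)
  have hPT : ∀ k < M, PowerSeries.coeff k (taylorPS P) = PowerSeries.coeff k Q := by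
    intro k hk
    have : taylorPS P = ∑ i ∈ Finset.range M, PowerSeries.C (q i) * PowerSeries.X ^ i := by
      rw [hP, taylorPS_sum _ (fun i => by fun_prop)]
      refine Finset.sum_congr rfl fun i _ => ?_
      rw [taylorPS_mul analyticAt_const (by fun_prop), taylorPS_const,
        taylorPS_pow (g := fun z => z) analyticAt_id, taylorPS_id]
    rw [this]
    simp [PowerSeries.coeff_X_pow, hk, hq]
  have hR : DifferentiableOn ℂ (fun z => ω z * P z) (ball 0 1) := hω.mul hPd.differentiableOn
  have hcoef : ∀ k < M, PowerSeries.coeff k (taylorPS fun z => ω z * P z) =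
      PowerSeries.coeff k (taylorPS ω * Q) := by
    intro k hk
    rw [taylorPS_mul hωa (hPd.analyticAt 0), PowerSeries.coeff_mul, PowerSeries.coeff_mul]
    refine Finset.sum_congr rfl fun x hx => ?_
    rw [hPT]
    have := Finset.HasAntidiagonal.mem_antidiagonal.mp hx
    omega
  have hle : ∀ z ∈ ball (0 : ℂ) 1, ‖ω z * P z‖ ≤ ‖∑ k ∈ Finset.range M, q k * z ^ k‖ := by
    intro z hz
    rw [norm_mul]
    exact mul_le_of_le_one_left (norm_nonneg _) (hb z hz)
  have key := bessel_aux hR q M hle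
  have l : ∀ c : ℕ → ℂ, Filter.Tendsto (fun r : ℝ => ∑ k ∈ Finset.range M, ‖c k * r ^ k‖ ^ 2)
      (𝓝[<] 1) (𝓝 (∑ k ∈ Finset.range M, ‖c k‖ ^ 2)) := by
    intro c
    have : Continuous (fun r : ℝ => ∑ k ∈ Finset.range M, ‖c k * (r : ℂ) ^ k‖ ^ 2) := by fun_prop
    simpa using (this.tendsto 1).mono_left nhdsWithin_le_nhds
  have := le_of_tendsto_of_tendsto (l _) (l _) (by
    filter_upwards [Ioo_mem_nhdsLT (zero_lt_one (α := ℝ))] with r hr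
    exact key r hr.1 hr.2)
  refine le_trans (le_of_eq ?_) this
  exact Finset.sum_congr rfl fun k hk => by rw [hcoef k (Finset.mem_range.mp hk)]

open PowerSeries in
lemma lagrange_aux (u v : PowerSeries ℂ) (huv : u * v = 1) (j : ℕ) (hj : 1 ≤ j) :
    coeff j (v ^ (j + 1) * derivative ℂ (X * u)) = 0 := by
  have hd : derivative ℂ u * v + u * derivative ℂ v = 0 := by
    have := congrArg (derivative ℂ) huv
    simpa [Derivation.leibniz, mul_comm, add_comm] using this
  have hv : derivative ℂ v = - (v ^ 2 * derivative ℂ u) := by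
    linear_combination v * hd - derivative ℂ v * huv
  obtain ⟨i, rfl⟩ : ∃ i, j = i + 1 := ⟨j - 1, by omega⟩
  have h1 : v ^ (i + 1 + 1) * derivative ℂ (X * u) =
      v ^ (i + 1) + X * (v ^ (i + 2) * derivative ℂ u) := by
    simp only [Derivation.leibniz, derivative_X, smul_eq_mul]
    linear_combination v ^ (i + 1) * huv
  have h2 : derivative ℂ (v ^ (i + 1)) =
      - C ((i : ℂ) + 1) * (v ^ (i + 2) * derivative ℂ u) := by
    rw [derivative_pow, hv]
    simp
    ring
  have h3 := congrArg (coeff i) h2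
  rw [coeff_derivative, ← map_neg, coeff_C_mul] at h3
  have hne : (i + 1 : ℂ) ≠ 0 := by exact_mod_cast Nat.succ_ne_zero i
  rw [h1, map_add, coeff_succ_X_mul]
  apply mul_right_cancel₀ hne
  linear_combination h3

open PowerSeries in
lemma lagrange (u v G : PowerSeries ℂ) (huv : u * v = 1) (a : ℕ → ℂ) (n : ℕ) (hn : 1 ≤ n)
    (h : (X : PowerSeries ℂ) = ∑ k ∈ Finset.range (n + 1), C (a k) * (X * u) ^ k +
      (X * u) ^ (n + 1) * G) :
    coeff (n - 1) (v ^ n) = n * a n := by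
  obtain ⟨m, rfl⟩ : ∃ m, n = m + 1 := ⟨n - 1, by omega⟩
  rw [Finset.sum_range_succ'] at h
  have h1 := congrArg (derivative ℂ) h
  simp only [map_add, map_sum, Derivation.leibniz _ (C _), Derivation.leibniz _ _ G,
    derivative_X, derivative_C, smul_eq_mul, mul_zero, add_zero, derivative_pow, pow_zero,
    mul_one, add_tsub_cancel_right] at h1
  have hvu : ∀ k, v ^ k * u ^ k = 1 := fun k => by rw [← mul_pow, mul_comm v, huv, one_pow]
  -- multiply by `v ^ (m+1)`
  have h2 : v ^ (m + 1) = ∑ k ∈ Finset.range (m + 1),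
      C (((k + 1 : ℕ) : ℂ) * a (k + 1)) * (X ^ k * (v ^ (m - k + 1) * derivative ℂ (X * u))) +
      X ^ (m + 1) * (v ^ (m + 1) * (X * u ^ (m + 2) * derivative ℂ G +
        G * (((m + 2 : ℕ) : PowerSeries ℂ) * u ^ (m + 1) * derivative ℂ (X * u)))) := by
    have h3 := congrArg (fun p => v ^ (m + 1) * p) h1
    simp only [mul_one, mul_add, Finset.mul_sum] at h3
    refine h3.trans ?_
    congr 1
    · refine Finset.sum_congr rfl fun k hk => ?_
      have hk' : k ≤ m := Nat.lt_succ_iff.mp (Finset.mem_range.mp hk)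
      have e : v ^ (m + 1) = v ^ (m - k + 1) * v ^ k := by
        rw [← pow_add]; congr 1; omega
      rw [e, mul_pow X u, map_mul C, map_natCast C]
      linear_combination (C (a (k + 1)) * ((k + 1 : ℕ) : PowerSeries ℂ) * X ^ k *
        v ^ (m - k + 1) * derivative ℂ (X * u)) * hvu k
    · rw [mul_pow X u, mul_pow X u]
      push_cast
      ring
  have h4 := congrArg (coeff m) h2
  simp only [map_add, map_sum, coeff_C_mul] at h4
  rw [add_tsub_cancel_right, h4, coeff_X_pow_mul', if_neg (by omega), add_zero,
    Finset.sum_range_succ, Finset.sum_eq_zero, zero_add]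
  · rw [coeff_X_pow_mul', if_pos le_rfl]
    simp only [le_refl, tsub_self, zero_add, pow_one]
    have e : constantCoeff v * constantCoeff u = 1 := by
      rw [← map_mul, mul_comm, huv, map_one]
    have : coeff 0 (v * derivative ℂ (X * u)) = 1 := by
      simp [Derivation.leibniz, e]
    rw [this, mul_one]
  · intro k hk
    have hk' := Finset.mem_range.mp hk
    rw [coeff_X_pow_mul', if_pos hk'.le, lagrange_aux u v huv _ (by omega), mul_zero]

lemma taylorPS_of_hasSum {F : ℂ → ℂ} {a : ℕ → ℂ} {ρ : ℝ} (hρ : 0 < ρ)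
    (h : ∀ w ∈ ball (0 : ℂ) ρ, HasSum (fun m : ℕ => a m * w ^ m) (F w)) :
    AnalyticAt ℂ F 0 ∧ ∀ k, iteratedDeriv k F 0 = (k ! : ℂ) * a k := by
  have hp : HasFPowerSeriesAt F (FormalMultilinearSeries.ofScalars ℂ a) 0 := by
    rw [hasFPowerSeriesAt_iff]
    filter_upwards [ball_mem_nhds (0 : ℂ) hρ] with w hw
    simpa [FormalMultilinearSeries.coeff_ofScalars, mul_comm] using h w hw
  refine ⟨hp.analyticAt, fun k => ?_⟩
  obtain ⟨r, hr⟩ := hp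
  have := hr.factorial_smul 1 k
  rw [iteratedDeriv_eq_iteratedFDeriv, ← this]
  simp [FormalMultilinearSeries.ofScalars]

open PowerSeries in
lemma ode_aux (u v w : PowerSeries ℂ) (huv : u * v = 1) (A B : ℂ) (n : ℕ)
    (h : X * derivative ℂ (X * u) * (1 + C B * X * w) = X * u * (1 + C A * X * w)) :
    derivative ℂ (v ^ n) = w * (-(C (n * (A - B)) * v ^ n + C B * (X * derivative ℂ (v ^ n)))) := by
  have hd : derivative ℂ u * v + u * derivative ℂ v = 0 := by
    have := congrArg (derivative ℂ) huv
    simpa [Derivation.leibniz, mul_comm, add_comm] using this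
  have hv : derivative ℂ v = - (v ^ 2 * derivative ℂ u) := by
    linear_combination v * hd - derivative ℂ v * huv
  have hX : (X : PowerSeries ℂ) ≠ 0 := X_ne_zero
  have h1 : derivative ℂ u * (1 + C B * X * w) = C (A - B) * w * u := by
    apply mul_left_cancel₀ (mul_ne_zero hX hX)
    simp only [Derivation.leibniz, derivative_X, smul_eq_mul] at h
    rw [map_sub]
    linear_combination h
  rcases n with _ | m
  · simp
  rw [derivative_pow, hv, add_tsub_cancel_right, map_mul, map_natCast]
  linear_combination (-((m + 1 : ℕ) : PowerSeries ℂ) * v ^ (m + 2)) * h1 -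
    ((m + 1 : ℕ) : PowerSeries ℂ) * C (A - B) * w * v ^ (m + 1) * huv

theorem inverse_coeff_bound_case_iii (A B δ : ℝ) (hB : -1 ≤ B) (hBA : B < A) (hA : A ≤ 1)
    (hδ : δ = (1 - A) / (1 - B))
    (f F : ℂ → ℂ) (hf : IsJanowskiStarlike A B f)
    (Acoef : ℕ → ℂ) (hA0 : Acoef 0 = 0) (hA1 : Acoef 1 = 1)
    (ρ : ℝ) (hρ : 0 < ρ)
    (hF : ∀ w ∈ ball (0 : ℂ) ρ,
      F w ∈ ball (0 : ℂ) 1 ∧ f (F w) = w ∧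
        HasSum (fun m : ℕ => Acoef m * w ^ m) (F w))
    (n : ℕ) (hn : 2 ≤ n) (hδ1 : ((n : ℝ) - 1) / n ≤ δ) (hδ2 : δ < 1) :
    ‖Acoef n‖ ≤ (A - B) / ((n : ℝ) - 1) := by
  obtain ⟨hfa, hf0, hf1, ω, hωa, hωb, hode⟩ := hf
  have hfd := hfa.differentiableOn
  have hωd := hωa.differentiableOn
  have h0 : ball (0 : ℂ) 1 ∈ 𝓝 (0 : ℂ) := ball_mem_nhds _ one_pos
  have hfA : AnalyticAt ℂ f 0 := hfd.analyticAt h0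
  have hωA : AnalyticAt ℂ ω 0 := hωd.analyticAt h0
  -- formal factorization of `f`
  obtain ⟨u, hu⟩ : (PowerSeries.X : PowerSeries ℂ) ∣ taylorPS f := by
    rw [PowerSeries.X_dvd_iff, ← PowerSeries.coeff_zero_eq_constantCoeff_apply]
    simp [taylorPS, hf0]
  have hu1 : PowerSeries.constantCoeff u = 1 := by
    have := congrArg (PowerSeries.coeff 1) hu
    rw [show (1 : ℕ) = 0 + 1 from rfl, PowerSeries.coeff_succ_X_mul] at this
    simpa [taylorPS, hf1, iteratedDeriv_one] using this.symm
  obtain ⟨v, huv⟩ : ∃ v, u * v = 1 :=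
    ⟨u⁻¹, PowerSeries.mul_inv_cancel u (by rw [hu1]; exact one_ne_zero)⟩
  have hv1 : PowerSeries.constantCoeff v = 1 := by
    have := congrArg PowerSeries.constantCoeff huv
    simpa [hu1] using this
  -- the differential equation
  have hODE := taylorPS_congr (Filter.eventually_of_mem h0 hode)
  rw [taylorPS_mul (by fun_prop) (by fun_prop), taylorPS_mul (by fun_prop) (by fun_prop),
    taylorPS_mul (by fun_prop) (by fun_prop), taylorPS_add (by fun_prop) (by fun_prop),
    taylorPS_add (by fun_prop) (by fun_prop), taylorPS_mul (by fun_prop) (by fun_prop),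
    taylorPS_mul (by fun_prop) (by fun_prop), taylorPS_mul (by fun_prop) (by fun_prop),
    taylorPS_mul (by fun_prop) (by fun_prop), taylorPS_id, taylorPS_const, taylorPS_const,
    taylorPS_const, map_one] at hODE
  rw [taylorPS_deriv, hu] at hODE
  have hg := ode_aux u v (taylorPS ω) huv A B n hODE
  -- inversion
  obtain ⟨hFA, hFc⟩ := taylorPS_of_hasSum hρ (fun w hw => (hF w hw).2.2)
  have hF0 : F 0 = 0 := by
    have := hFc 0
    simpa [hA0] using this
  have hinv : ∀ᶠ z in 𝓝 (0 : ℂ), F (f z) = z := by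
    have hs : HasStrictDerivAt f 1 0 := hf1 ▸ hfA.hasStrictDerivAt
    have e1 := hs.eventually_left_inverse one_ne_zero
    have hfc : Filter.Tendsto f (𝓝 0) (𝓝 0) := by
      simpa [hf0] using hfA.continuousAt.tendsto
    have hFt : Filter.Tendsto F (𝓝 0) (𝓝 0) := by
      simpa [hF0] using hFA.continuousAt.tendsto
    filter_upwards [e1, (hFt.comp hfc).eventually e1,
      hfc.eventually (ball_mem_nhds (0 : ℂ) hρ)] with z h1 h2 h3
    have h4 := (hF _ h3).2.1
    simp only [Function.comp] at h2
    rw [h4, h1] at h2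
    exact h2.symm
  obtain ⟨G, hGA, hG⟩ := hFA.exists_eq_sum_add_pow_mul (n + 1)
  have hGf : AnalyticAt ℂ (fun z => G (f z)) 0 := by
    apply AnalyticAt.fun_comp _ hfA
    rwa [hf0]
  have hcoef : PowerSeries.coeff (n - 1) (v ^ n) = n * Acoef n := by
    apply lagrange u v (taylorPS fun z => G (f z)) huv Acoef n (by omega)
    have e : (fun z : ℂ => z) =ᶠ[𝓝 0] fun z =>
        (∑ k ∈ Finset.range (n + 1), Acoef k * f z ^ k) + f z ^ (n + 1) * G (f z) := by
      filter_upwards [hinv] with z hz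
      refine (hz.symm.trans (hG (f z))).trans ?_
      simp only [smul_eq_mul, hFc]
      congr 1
      refine Finset.sum_congr rfl fun k _ => ?_
      have : (k ! : ℂ) ≠ 0 := by exact_mod_cast Nat.factorial_ne_zero k
      field_simp
    have e2 := taylorPS_congr e
    rw [taylorPS_id, taylorPS_add (Finset.analyticAt_fun_sum _ fun i _ => by fun_prop)
      ((hfA.fun_pow _).fun_mul hGf), taylorPS_sum _ (fun i => by fun_prop), taylorPS_mul (by fun_prop) hGf,
      taylorPS_pow hfA, hu] at e2
    refine e2.trans ?_
    congr 1
    refine Finset.sum_congr rfl fun k _ => ?_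
    rw [taylorPS_mul (by fun_prop) (by fun_prop), taylorPS_pow hfA, taylorPS_const, hu]
  -- Clunie's inequality
  have hcl := clunie hωd hωb (-(PowerSeries.C ((n : ℂ) * (A - B)) * v ^ n +
    PowerSeries.C (B : ℂ) * (PowerSeries.X * PowerSeries.derivative ℂ (v ^ n)))) (n - 1)
  rw [← hg] at hcl
  set a : ℕ → ℂ := fun k => PowerSeries.coeff k (v ^ n) with ha
  have hL : ∀ k, ‖PowerSeries.coeff k (PowerSeries.derivative ℂ (v ^ n))‖ ^ 2 =
      ((k : ℝ) + 1) ^ 2 * ‖a (k + 1)‖ ^ 2 := by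
    intro k
    rw [PowerSeries.coeff_derivative, norm_mul, mul_pow, mul_comm]
    congr 2
    exact_mod_cast Complex.norm_natCast (k + 1)
  have hXd : ∀ k, PowerSeries.coeff k (PowerSeries.X * PowerSeries.derivative ℂ (v ^ n)) =
      k * a k := by
    intro k
    cases k with
    | zero => simp
    | succ k =>
      rw [PowerSeries.coeff_succ_X_mul, PowerSeries.coeff_derivative]
      push_cast
      ring
  have hRt : ∀ k, ‖PowerSeries.coeff k (-(PowerSeries.C ((n : ℂ) * (A - B)) * v ^ n +
      PowerSeries.C (B : ℂ) * (PowerSeries.X * PowerSeries.derivative ℂ (v ^ n))))‖ ^ 2 =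
      ((n : ℝ) * (A - B) + B * k) ^ 2 * ‖a k‖ ^ 2 := by
    intro k
    rw [map_neg, norm_neg, map_add, PowerSeries.coeff_C_mul, PowerSeries.coeff_C_mul, hXd]
    have : (n : ℂ) * (A - B) * PowerSeries.coeff k (v ^ n) + B * (k * a k) =
        (((n : ℝ) * (A - B) + B * k : ℝ) : ℂ) * a k := by
      push_cast
      ring
    rw [this, norm_mul, mul_pow, Complex.norm_real, Real.norm_eq_abs, sq_abs]
  simp only [hL, hRt] at hcl
  obtain ⟨m, rfl⟩ : ∃ m, n = m + 2 := ⟨n - 2, by omega⟩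
  rw [show m + 2 - 1 = m + 1 from rfl] at hcl hcoef
  rw [Finset.sum_range_succ, Finset.sum_range_succ'] at hcl
  have ha0 : a 0 = 1 := by simp [ha, hv1]
  -- parameter estimates
  have hB1 : 0 < 1 - B := by linarith
  have hnpos : (0 : ℝ) < ((m + 2 : ℕ) : ℝ) := by positivity
  have hnAB : ((m + 2 : ℕ) : ℝ) * (A - B) ≤ 1 - B := by
    rw [hδ, div_le_div_iff₀ hnpos hB1] at hδ1
    nlinarith
  have hterm : ∀ k ∈ Finset.range m,
      (((m + 2 : ℕ) : ℝ) * (A - B) + B * ((k + 1 : ℕ) : ℝ)) ^ 2 * ‖a (k + 1)‖ ^ 2 ≤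
      ((k : ℝ) + 1) ^ 2 * ‖a (k + 1)‖ ^ 2 := by
    intro k _
    have hk : (0 : ℝ) ≤ k := Nat.cast_nonneg k
    have h5 : 0 ≤ ((m + 2 : ℕ) : ℝ) * (A - B) := mul_nonneg hnpos.le (by linarith)
    apply mul_le_mul_of_nonneg_right _ (by positivity)
    apply sq_le_sq'
    · push_cast at *
      nlinarith
    · push_cast at *
      nlinarith
  have hs := Finset.sum_le_sum hterm
  have hfin : ((m : ℝ) + 1) ^ 2 * ‖a (m + 1)‖ ^ 2 ≤ (((m + 2 : ℕ) : ℝ) * (A - B)) ^ 2 := by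
    rw [ha0] at hcl
    simp only [Nat.cast_zero, mul_zero, add_zero, norm_one, one_pow, mul_one] at hcl
    linarith
  have hnn : 0 ≤ ((m + 2 : ℕ) : ℝ) * (A - B) := mul_nonneg hnpos.le (by linarith)
  rw [← mul_pow] at hfin
  have hfin2 := le_of_sq_le_sq hfin hnn
  have han : ‖a (m + 1)‖ = ((m + 2 : ℕ) : ℝ) * ‖Acoef (m + 2)‖ := by
    simp only [ha, hcoef, norm_mul, Complex.norm_natCast]
  rw [han] at hfin2
  have hm1 : (0 : ℝ) < ((m + 2 : ℕ) : ℝ) - 1 := by push_cast; linarith [Nat.cast_nonneg (α := ℝ) m]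
  rw [le_div_iff₀ hm1]
  apply le_of_mul_le_mul_left _ hnpos
  refine le_trans (le_of_eq ?_) hfin2
  push_cast
  ring
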